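/- Let U ⊆ ℂ be open, let u : U → ℂ be holomorphic, c ∈ ℂ, m ≥ 1 an integer, and let α_0, α_1, …, α_m : U → ℂ be functions. Then for each z ∈ U, the m-th Riccati chain equation (L^m u)(z) + Σ_{j=1}^{m} α_j(z)·(L^{j-1} u)(z) + α_0(z) = 0 holds if and only if Σ_{k=1}^{m+1} c^{k-1}·B_{m+1,k}(u(z),u'(z),…,u^{(m)}(z)) + Σ_{j=1}^{m} α_j(z)·Σ_{k=1}^{j} c^{k-1}·B_{j,k}(u(z),u'(z),…,u^{(j-1)}(z)) + α_0(z) = 0. -/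

import Mathlib

open Finset

/-- The exponential partial Bell polynomial `B_{m,k}(x 1, …, x (m-k+1))`. -/
noncomputable def bellPartial (m k : ℕ) (x : ℕ → ℂ) : ℂ :=
  ∑ j ∈ (Fintype.piFinset (fun _ : Fin (m - k + 1) => Finset.range (m + 1))).filter
      (fun (j : Fin (m - k + 1) → ℕ) =>
        (∑ i : Fin (m - k + 1), j i) = k ∧
        (∑ i : Fin (m - k + 1), ((i : ℕ) + 1) * j i) = m),
    (Nat.factorial m : ℂ) / (∏ i : Fin (m - k + 1), (Nat.factorial (j i) : ℂ)) *
      ∏ i : Fin (m - k + 1),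
        (x ((i : ℕ) + 1) / (Nat.factorial ((i : ℕ) + 1) : ℂ)) ^ (j i)

/-- The operator `L = d/dz + c·u` acting on functions: `(L g)(z) = g'(z) + c·u(z)·g(z)`. -/
noncomputable def riccatiL (c : ℂ) (u : ℂ → ℂ) (g : ℂ → ℂ) : ℂ → ℂ :=
  fun z => deriv g z + c * u z * g z

open PowerSeries in
/-- The exponential generating function `∑_{i ≥ 1} x i * X ^ i / i!`. -/
noncomputable def bellSeries (x : ℕ → ℂ) : ℂ⟦X⟧ :=
  X * PowerSeries.mk fun i => x (i + 1) / (Nat.factorial (i + 1) : ℂ)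

open PowerSeries in
theorem PowerSeries.coeff_pow_eq_sum_multinomial {R : Type*} [CommRing R] (f : R⟦X⟧) (d k : ℕ) :
    coeff d (f ^ k) = ∑ j ∈ (Finset.univ : Finset (Fin (d + 1))).piAntidiag k,
      if ∑ i : Fin (d + 1), (i : ℕ) * j i = d then
        (Nat.multinomial Finset.univ j : R) * ∏ i : Fin (d + 1), coeff (i : ℕ) f ^ j i
      else 0 := by
  have htrunc : trunc (d + 1) f =
      ∑ i : Fin (d + 1), Polynomial.C (coeff (i : ℕ) f) * Polynomial.X ^ (i : ℕ) := by
    rw [Fin.sum_univ_eq_sum_range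
      (fun i => Polynomial.C (coeff i f) * Polynomial.X ^ i) (d + 1)]
    ext n
    simp [coeff_trunc, Polynomial.coeff_C_mul, Polynomial.coeff_X_pow]
  rw [← coeff_coe_trunc_of_lt d.lt_succ_self, ← trunc_trunc_pow,
    coeff_coe_trunc_of_lt d.lt_succ_self, ← Polynomial.coe_pow, Polynomial.coeff_coe,
    htrunc, Finset.sum_pow_eq_sum_piAntidiag, Polynomial.finsetSum_coeff]
  refine Finset.sum_congr rfl fun j _ => ?_
  simp only [mul_pow, Finset.prod_mul_distrib, ← pow_mul, Finset.prod_pow_eq_pow_sum,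
    ← map_pow, ← map_prod]
  rw [← Polynomial.C_eq_natCast, ← mul_assoc, ← map_mul, Polynomial.coeff_C_mul,
    Polynomial.coeff_X_pow]
  simp [eq_comm]

open PowerSeries in
theorem bellPartial_eq_coeff {m k : ℕ} (hk : k ≤ m) (x : ℕ → ℂ) :
    bellPartial m k x =
      (Nat.factorial m : ℂ) / (Nat.factorial k : ℂ) * coeff m (bellSeries x ^ k) := by
  rw [bellSeries, mul_pow, coeff_X_pow_mul', if_pos hk, coeff_pow_eq_sum_multinomial,
    ← Finset.sum_filter, Finset.mul_sum, bellPartial]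
  have hindex : (Fintype.piFinset (fun _ : Fin (m - k + 1) => Finset.range (m + 1))).filter
      (fun (j : Fin (m - k + 1) → ℕ) =>
        (∑ i : Fin (m - k + 1), j i) = k ∧
        (∑ i : Fin (m - k + 1), ((i : ℕ) + 1) * j i) = m) =
      ((Finset.univ : Finset (Fin (m - k + 1))).piAntidiag k).filter
        (fun j => ∑ i : Fin (m - k + 1), (i : ℕ) * j i = m - k) := by
    ext j
    have hle (i) : j i ≤ ∑ i, j i := Finset.single_le_sum (fun _ _ => Nat.zero_le _)
      (Finset.mem_univ i)
    simp only [Finset.mem_filter, Fintype.mem_piFinset, Finset.mem_range, Finset.mem_piAntidiag,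
      add_mul, one_mul, Finset.sum_add_distrib, Finset.mem_univ, implies_true, and_true]
    constructor
    · rintro ⟨-, h₁, h₂⟩
      exact ⟨h₁, by omega⟩
    · rintro ⟨h₁, h₂⟩
      replace h₁ : ∑ i, j i = k := h₁
      exact ⟨fun i => by have := hle i; omega, h₁, by omega⟩
  rw [hindex]
  refine Finset.sum_congr rfl fun j hj => ?_
  simp only [Finset.mem_filter, Finset.mem_piAntidiag] at hj
  have hspec := Nat.multinomial_spec Finset.univ j
  rw [hj.1.1] at hspec
  have hprod : (∏ i, (Nat.factorial (j i) : ℂ)) ≠ 0 :=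
    Finset.prod_ne_zero_iff.mpr fun i _ => by exact_mod_cast Nat.factorial_ne_zero _
  have hfac : (Nat.factorial k : ℂ) ≠ 0 := by exact_mod_cast Nat.factorial_ne_zero _
  simp only [coeff_mk]
  rw [← mul_assoc]
  congr 1
  have hspec' : (∏ i, (Nat.factorial (j i) : ℂ)) * (Nat.multinomial Finset.univ j : ℂ) =
      (Nat.factorial k : ℂ) := by exact_mod_cast hspec
  field_simp
  rw [← hspec']
  ring

open PowerSeries in
theorem hasDerivAt_coeff_pow {𝕜 : Type*} [NontriviallyNormedField 𝕜] {F : 𝕜 → 𝕜⟦X⟧} {F' : 𝕜⟦X⟧}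
    {z : 𝕜} (hF : ∀ n, HasDerivAt (fun w => coeff n (F w)) (coeff n F') z) (k n : ℕ) :
    HasDerivAt (fun w => coeff n (F w ^ k)) (coeff n (k * F z ^ (k - 1) * F')) z := by
  induction k generalizing n with
  | zero => simpa using hasDerivAt_const z (coeff n (1 : 𝕜⟦X⟧))
  | succ k ih =>
    have hsplit : ((k + 1 : ℕ) : 𝕜⟦X⟧) * F z ^ (k + 1 - 1) * F' =
        k * F z ^ (k - 1) * F' * F z + F z ^ k * F' := by
      rcases k with _ | k
      · simp
      · push_cast
        ring
    rw [hsplit, map_add, coeff_mul, coeff_mul, ← Finset.sum_add_distrib]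
    simp only [pow_succ, coeff_mul _ (F _ ^ k)]
    exact HasDerivAt.fun_sum fun p _ => (ih p.1).mul (hF p.2)

open PowerSeries in
/-- If `x i` has derivative `x (i + 1)`, then the generating function depends on the point with
derivative equal to its own formal derivative minus `x 1`. -/
theorem hasDerivAt_coeff_bellSeries {x : ℂ → ℕ → ℂ} {z : ℂ}
    (hx : ∀ i, HasDerivAt (fun w => x w (i + 1)) (x z (i + 2)) z) (n : ℕ) :
    HasDerivAt (fun w => coeff n (bellSeries (x w)))
      (coeff n (d⁄dX ℂ (bellSeries (x z)) - C (x z 1))) z := by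
  rcases n with _ | n
  · simpa [bellSeries, coeff_derivative, coeff_succ_X_mul] using hasDerivAt_const z (0 : ℂ)
  · have hderiv : coeff (n + 1) (d⁄dX ℂ (bellSeries (x z)) - C (x z 1)) =
        x z (n + 2) / (Nat.factorial (n + 1) : ℂ) := by
      have hfac : (Nat.factorial (n + 1) : ℂ) ≠ 0 := by exact_mod_cast Nat.factorial_ne_zero _
      have hne : ((n : ℂ) + 1 + 1) ≠ 0 := by exact_mod_cast Nat.succ_ne_zero (n + 1)
      rw [map_sub, coeff_derivative, coeff_C, if_neg n.succ_ne_zero, bellSeries,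
        coeff_succ_X_mul, coeff_mk, Nat.factorial_succ (n + 1)]
      push_cast
      field_simp
      ring
    rw [hderiv]
    simpa only [bellSeries, coeff_succ_X_mul, coeff_mk] using (hx n).div_const _

open PowerSeries in
theorem hasDerivAt_bellPartial {x : ℂ → ℕ → ℂ} {z : ℂ}
    (hx : ∀ i, HasDerivAt (fun w => x w (i + 1)) (x z (i + 2)) z) {n k : ℕ} (hk : k + 1 ≤ n) :
    HasDerivAt (fun w => bellPartial n (k + 1) (x w))
      (bellPartial (n + 1) (k + 1) (x z) - x z 1 * bellPartial n k (x z)) z := by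
  have h := (hasDerivAt_coeff_pow (hasDerivAt_coeff_bellSeries hx) (k + 1) n).const_mul
    ((Nat.factorial n : ℂ) / (Nat.factorial (k + 1) : ℂ))
  simp only [bellPartial_eq_coeff hk, bellPartial_eq_coeff (Nat.le_of_succ_le hk),
    bellPartial_eq_coeff (Nat.le_succ_of_le hk)]
  refine h.congr_deriv ?_
  rw [mul_sub, ← derivative_pow, map_sub, coeff_derivative, coeff_mul_C, Nat.add_sub_cancel,
    ← map_natCast (C (R := ℂ)), coeff_C_mul, Nat.factorial_succ n, Nat.factorial_succ k]
  have hfac : (Nat.factorial k : ℂ) ≠ 0 := by exact_mod_cast Nat.factorial_ne_zero _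
  have hne : (k : ℂ) + 1 ≠ 0 := by exact_mod_cast Nat.succ_ne_zero k
  push_cast
  field_simp

theorem bellPartial_zero_right (n : ℕ) (x : ℕ → ℂ) : bellPartial (n + 1) 0 x = 0 := by
  simp [bellPartial_eq_coeff (Nat.zero_le _), PowerSeries.coeff_one]

open PowerSeries in
theorem bellPartial_self (n : ℕ) (x : ℕ → ℂ) : bellPartial n n x = x 1 ^ n := by
  rw [bellPartial_eq_coeff le_rfl, bellSeries, mul_pow, coeff_X_pow_mul', if_pos le_rfl,
    Nat.sub_self, coeff_zero_eq_constantCoeff_apply, map_pow,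
    ← coeff_zero_eq_constantCoeff_apply, coeff_mk,
    div_self (by exact_mod_cast Nat.factorial_ne_zero _)]
  simp

theorem riccatiL_iterate_eq_sum_bellPartial {U : Set ℂ} (hU : IsOpen U) {u : ℂ → ℂ}
    (hu : DifferentiableOn ℂ u U) (c : ℂ) (n : ℕ) {z : ℂ} (hz : z ∈ U) :
    (riccatiL c u)^[n] u z = ∑ k ∈ Finset.range (n + 1),
      c ^ k * bellPartial (n + 1) (k + 1) (fun i => iteratedDeriv (i - 1) u z) := by
  induction n generalizing z with
  | zero => simp [bellPartial_self]
  | succ n ih =>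
    have hx (i : ℕ) : HasDerivAt (fun w => iteratedDeriv (i + 1 - 1) u w)
        (iteratedDeriv (i + 2 - 1) u z) z := by
      have han := ((hu.analyticOnNhd hU) z hz).iterated_deriv i
      rw [← iteratedDeriv_eq_iterate] at han
      simpa [iteratedDeriv_succ] using han.differentiableAt.hasDerivAt
    have hderiv := HasDerivAt.fun_sum (u := Finset.range (n + 1)) fun k hk =>
      (hasDerivAt_bellPartial (x := fun w i => iteratedDeriv (i - 1) u w) hx
        (Nat.succ_le_of_lt (Finset.mem_range.mp hk))).const_mul (c ^ k)
    have heq : (riccatiL c u)^[n] u =ᶠ[nhds z] fun w => ∑ k ∈ Finset.range (n + 1),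
        c ^ k * bellPartial (n + 1) (k + 1) (fun i => iteratedDeriv (i - 1) u w) := by
      filter_upwards [hU.mem_nhds hz] with w hw using ih hw
    rw [Function.iterate_succ_apply', riccatiL, heq.deriv_eq, hderiv.deriv, ih hz,
      Finset.sum_range_succ _ (n + 1)]
    simp only [mul_sub, Finset.sum_sub_distrib]
    rw [Finset.sum_range_succ' (fun k => c ^ k * (_ * _)), bellPartial_zero_right,
      Finset.sum_range_succ (fun k => c ^ k * bellPartial (n + 1) (k + 1) _), mul_add,
      Finset.mul_sum]
    simp only [Nat.sub_self, iteratedDeriv_zero, pow_succ]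
    have hshift : ∑ k ∈ Finset.range n, c ^ k * c *
        (u z * bellPartial (n + 1) (k + 1) fun i => iteratedDeriv (i - 1) u z) =
        ∑ k ∈ Finset.range n, c * u z *
          (c ^ k * bellPartial (n + 1) (k + 1) fun i => iteratedDeriv (i - 1) u z) :=
      Finset.sum_congr rfl fun _ _ => by ring
    rw [hshift, bellPartial_self, bellPartial_self]
    simp only [Nat.sub_self, iteratedDeriv_zero]
    ring

theorem riccatiL_iterate_eq_sum_Icc_bellPartial {U : Set ℂ} (hU : IsOpen U) {u : ℂ → ℂ}
    (hu : DifferentiableOn ℂ u U) (c : ℂ) {n : ℕ} (hn : 1 ≤ n) {z : ℂ} (hz : z ∈ U) :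
    (riccatiL c u)^[n - 1] u z = ∑ k ∈ Finset.Icc 1 n,
      c ^ (k - 1) * bellPartial n k (fun i => iteratedDeriv (i - 1) u z) := by
  rw [riccatiL_iterate_eq_sum_bellPartial hU hu c _ hz, Nat.sub_add_cancel hn,
    ← Finset.Ico_add_one_right_eq_Icc, Finset.sum_Ico_eq_sum_range]
  simp [add_comm 1]

/-- The `m`-th Riccati chain equation
`L^m u + ∑_{j=1}^m α_j L^{j-1} u + α_0 = 0` at a point `z ∈ U` holds iff its
Bell-polynomial form holds. -/
theorem riccatiChain_iff_bellForm (U : Set ℂ) (hU : IsOpen U) (u : ℂ → ℂ)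
    (hu : DifferentiableOn ℂ u U) (c : ℂ) (m : ℕ) (hm : 1 ≤ m)
    (α : ℕ → ℂ → ℂ) (z : ℂ) (hz : z ∈ U) :
    ((riccatiL c u)^[m] u z
        + (∑ j ∈ Finset.Icc 1 m, α j z * (riccatiL c u)^[j - 1] u z) + α 0 z = 0)
      ↔ ((∑ k ∈ Finset.Icc 1 (m + 1),
            c ^ (k - 1) * bellPartial (m + 1) k (fun i => iteratedDeriv (i - 1) u z))
          + (∑ j ∈ Finset.Icc 1 m, α j z *
              ∑ k ∈ Finset.Icc 1 j,
                c ^ (k - 1) * bellPartial j k (fun i => iteratedDeriv (i - 1) u z))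
          + α 0 z = 0) := by
  rw [Finset.sum_congr rfl fun j hj => congrArg (α j z * ·)
      (riccatiL_iterate_eq_sum_Icc_bellPartial hU hu c (Finset.mem_Icc.mp hj).1 hz),
    ← riccatiL_iterate_eq_sum_Icc_bellPartial hU hu c (Nat.le_add_left 1 m) hz,
    Nat.add_sub_cancel]
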